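/- arXiv:1310.1376 — 7 statements merged into one kernel-verified Lean document; each statement's English description precedes it below -/
import Mathlib

section
/- In a finite connected graph, any two longest paths share at least one common vertex. -/
open SimpleGraph

/-- A walk `p` is a longest path in `G` if it is a path and no path in `G` is longer. -/
def IsLongestPath {V : Type*} (G : SimpleGraph V) {a b : V} (p : G.Walk a b) : Prop :=
  p.IsPath ∧ ∀ (c d : V) (q : G.Walk c d), q.IsPath → q.length ≤ p.length

theorem aux_half {V : Type} [DecidableEq V] {G : SimpleGraph V} {a b x : V} (p : G.Walk a b)
    (hp : p.IsPath) (hx : x ∈ p.support) :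
    ∃ (u : V) (w : G.Walk u x), w.IsPath ∧ w.support ⊆ p.support ∧ p.length ≤ 2 * w.length := by
  have h := congrArg Walk.length (p.take_spec hx)
  rw [Walk.length_append] at h
  by_cases hc : (p.dropUntil x hx).length ≤ (p.takeUntil x hx).length
  · exact ⟨a, p.takeUntil x hx, hp.takeUntil hx, p.support_takeUntil_subset_support hx, by omega⟩
  · refine ⟨b, (p.dropUntil x hx).reverse, (hp.dropUntil hx).reverse, ?_, ?_⟩
    · intro v hv
      rw [Walk.support_reverse, List.mem_reverse] at hv
      exact p.support_dropUntil_subset_support hx hv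
    · rw [Walk.length_reverse]; omega

theorem aux_append {V : Type} {G : SimpleGraph V} {a b c : V} (p : G.Walk a b) (q : G.Walk b c)
    (hp : p.IsPath) (hq : q.IsPath) (h : ∀ v ∈ p.support, v ∈ q.support → v = b) :
    (p.append q).IsPath := by
  rw [Walk.isPath_def, Walk.support_append, List.nodup_append']
  have hq' := hq.support_nodup
  rw [← Walk.cons_tail_support, List.nodup_cons] at hq'
  refine ⟨hp.support_nodup, hq'.2, ?_⟩
  intro v hv hv'
  have := h v hv (List.mem_of_mem_tail hv')
  subst this
  exact hq'.1 hv'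

/-- In a finite connected graph, any two longest paths share a common vertex. -/
theorem longestPaths_intersect {V : Type} [Fintype V] (G : SimpleGraph V)
    (hconn : G.Connected) {a b c d : V} (p : G.Walk a b) (q : G.Walk c d)
    (hp : IsLongestPath G p) (hq : IsLongestPath G q) :
    ∃ v : V, v ∈ p.support ∧ v ∈ q.support := by
  classical
  by_contra hno
  push Not at hno
  have hex : ∃ n, ∃ (x y : V) (r : G.Walk x y),
      x ∈ p.support ∧ y ∈ q.support ∧ r.length = n := by
    obtain ⟨r⟩ := hconn.preconnected a c
    exact ⟨_, a, c, r, p.start_mem_support, q.start_mem_support, rfl⟩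
  obtain ⟨x, y, r, hx, hy, hr⟩ := Nat.find_spec hex
  have hmin : ∀ (x' y' : V) (r' : G.Walk x' y'), x' ∈ p.support → y' ∈ q.support →
      r.length ≤ r'.length := by
    intro x' y' r' h1 h2
    rw [hr]
    exact Nat.find_min' hex ⟨x', y', r', h1, h2, rfl⟩
  clear hr
  wlog hrp : r.IsPath generalizing r
  · exact this r.bypass (fun x' y' r' h1 h2 =>
      (r.length_bypass_le_length).trans (hmin x' y' r' h1 h2)) r.bypass_isPath
  have hrx : ∀ v ∈ r.support, v ∈ p.support → v = x := by
    intro v hv hvp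
    have h := congrArg Walk.length (r.take_spec hv)
    rw [Walk.length_append] at h
    have h2 := hmin v y (r.dropUntil v hv) hvp hy
    exact (Walk.eq_of_length_eq_zero (p := r.takeUntil v hv) (by omega)).symm
  have hry : ∀ v ∈ r.support, v ∈ q.support → v = y := by
    intro v hv hvq
    have h := congrArg Walk.length (r.take_spec hv)
    rw [Walk.length_append] at h
    have h2 := hmin x v (r.takeUntil v hv) hx hvq
    exact Walk.eq_of_length_eq_zero (p := r.dropUntil v hv) (by omega)
  have hpos : r.length ≠ 0 := by
    intro h0
    have := Walk.eq_of_length_eq_zero h0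
    subst this
    exact hno x hx hy
  obtain ⟨u, w, hw, hws, hwl⟩ := aux_half p hp.1 hx
  obtain ⟨u', w', hw', hws', hwl'⟩ := aux_half q hq.1 hy
  have h1 : (r.append w'.reverse).IsPath := by
    refine aux_append _ _ hrp hw'.reverse fun v hv hv' => hry v hv (hws' ?_)
    simpa using hv'
  have h2 : (w.append (r.append w'.reverse)).IsPath := by
    refine aux_append _ _ hw h1 fun v hv hv' => ?_
    rw [Walk.mem_support_append_iff] at hv'
    rcases hv' with hv' | hv'
    · exact hrx v hv' (hws hv)
    · exact absurd (hws' (by simpa using hv')) (hno v (hws hv))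
  have e1 := hp.2 _ _ _ h2
  have e2 := hq.2 _ _ _ h2
  simp only [Walk.length_append, Walk.length_reverse] at e1 e2
  omega
end

section
/- In a finite graph, let P1 and P2 be two paths that share a common vertex z, let R1 be a tail of P1 starting at z, and let R2 be a union of pairwise internally vertex-disjoint subpaths of P2 (they may share endpoints) such that every path in R2 has as one of its endpoints either z or an endpoint of P2. Suppose the vertex intersection of R1 with P2 equals {z} and the vertex intersection of R2 with P1 is contained in {z}. If there exists a path P not containing z such that the vertex set of P intersects P1 in a nonempty set contained in R1, and intersects P2 in a nonempty set contained in R2, then P1 and P2 cannot both be longest paths. -/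
open SimpleGraph

namespace SimpleGraph.Walk

/-- `R` is a prefix of the walk `P`. -/
def IsPrefixOf {V : Type*} {G : SimpleGraph V} {u v w x : V}
    (R : G.Walk u v) (P : G.Walk w x) : Prop :=
  ∃ (hu : u = w) (Q : G.Walk v x), P = (R.copy hu rfl).append Q

/-- `R` is a suffix of the walk `P`. -/
def IsSuffixOf {V : Type*} {G : SimpleGraph V} {u v w x : V}
    (R : G.Walk u v) (P : G.Walk w x) : Prop :=
  ∃ (hv : v = x) (Q : G.Walk w u), P = Q.append (R.copy rfl hv)

/-- `R` is a tail of `P`: a subpath of `P` containing an endpoint of `P`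
(up to orientation). -/
def IsTailOf {V : Type*} {G : SimpleGraph V} {u v w x : V}
    (R : G.Walk u v) (P : G.Walk w x) : Prop :=
  R.IsPrefixOf P ∨ R.IsSuffixOf P ∨ R.reverse.IsPrefixOf P ∨ R.reverse.IsSuffixOf P

/-- `R` is an infix of the walk `P`. -/
def IsInfixOf {V : Type*} {G : SimpleGraph V} {u v w x : V}
    (R : G.Walk u v) (P : G.Walk w x) : Prop :=
  ∃ (Q₁ : G.Walk w u) (Q₂ : G.Walk v x), P = Q₁.append (R.append Q₂)

/-- `R` is a subpath of `P` (an infix, up to orientation). -/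
def IsSubpathOf {V : Type*} {G : SimpleGraph V} {u v w x : V}
    (R : G.Walk u v) (P : G.Walk w x) : Prop :=
  R.IsInfixOf P ∨ R.reverse.IsInfixOf P

/-- `R` is one of the two tails of `P` obtained by splitting `P` at the vertex `z`
(up to orientation). -/
def IsTailFrom {V : Type*} {G : SimpleGraph V} (z : V) {u v w x : V}
    (R : G.Walk u v) (P : G.Walk w x) : Prop :=
  (R.IsPrefixOf P ∧ v = z) ∨ (R.IsSuffixOf P ∧ u = z) ∨
  (R.reverse.IsPrefixOf P ∧ u = z) ∨ (R.reverse.IsSuffixOf P ∧ v = z)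

end SimpleGraph.Walk

namespace LongestAux

open SimpleGraph.Walk

variable {V : Type} {G : SimpleGraph V}

theorem isPath_append_iff' {u v w : V} (p : G.Walk u v) (q : G.Walk v w) :
    (p.append q).IsPath ↔ p.IsPath ∧ q.IsPath ∧ ∀ t, t ∈ p.support → t ∈ q.support → t = v := by
  constructor
  · intro h
    refine ⟨h.of_append_left, h.of_append_right, fun t h1 h2 => ?_⟩
    by_contra hne
    exact h.ne_of_mem_support_of_append hne h1 h2 rfl
  · rintro ⟨h1, h2, h3⟩
    rw [isPath_def] at *
    rw [support_append, List.nodup_append']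
    have hq := q.cons_tail_support.symm
    rw [hq, List.nodup_cons] at h2
    refine ⟨h1, h2.2, fun t ht1 ht2 => ?_⟩
    have := h3 t ht1 (by rw [hq]; exact List.mem_cons_of_mem _ ht2)
    subst this
    exact h2.1 ht2

theorem core1 {a₁ b₁ a₂ b₂ x y z : V} (L : G.Walk a₁ z) (A₁ : G.Walk z x) (B₁ : G.Walk x b₁)
    (A : G.Walk a₂ z) (C : G.Walk z y) (D : G.Walk y b₂) (S : G.Walk x y)
    (hS : S.IsPath) (hxz : x ≠ z) (hyz : y ≠ z) (hxy : x ≠ y)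
    (hR : ∀ v, v ∈ (A₁.append B₁).support → v ∈ (A.append (C.append D)).support → v = z)
    (hS1 : ∀ v, v ∈ S.support → v ∈ (L.append (A₁.append B₁)).support → v = x)
    (hS2 : ∀ v, v ∈ S.support → v ∈ (A.append (C.append D)).support → v = y)
    (hC : ∀ v, v ∈ C.support → v ∈ (L.append (A₁.append B₁)).support → v = z)
    (h1 : IsLongestPath G (L.append (A₁.append B₁)))
    (h2 : IsLongestPath G (A.append (C.append D))) : False := by
  obtain ⟨p1, m1⟩ := h1
  obtain ⟨p2, m2⟩ := h2
  have k1 := m1 _ _ (L.append (C.append (S.reverse.append B₁)))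
  have k2 := m2 _ _ (A.append (A₁.append (S.append D)))
  have hs : S.length ≠ 0 := fun h => hxy (eq_of_length_eq_zero h)
  have hSr := hS.reverse
  simp only [isPath_append_iff', mem_support_append_iff, length_append, length_reverse,
    support_reverse, List.mem_reverse] at *
  have k1' := k1 (by
    have e1 := S.end_mem_support
    have e2 := C.end_mem_support
    have e3 := D.start_mem_support
    have e4 := C.start_mem_support
    have e5 := B₁.start_mem_support
    have e6 := A₁.start_mem_support
    have e7 := A₁.end_mem_support
    have e8 := L.end_mem_support
    have e9 := A.end_mem_support
    have e10 := S.start_mem_support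
    clear k1 k2 m1 m2
    grind)
  have k2' := k2 (by
    have e1 := S.end_mem_support
    have e2 := C.end_mem_support
    have e3 := D.start_mem_support
    have e4 := C.start_mem_support
    have e5 := B₁.start_mem_support
    have e6 := A₁.start_mem_support
    have e7 := A₁.end_mem_support
    have e8 := L.end_mem_support
    have e9 := A.end_mem_support
    have e10 := S.start_mem_support
    clear k1 k2 m1 m2
    grind)
  omega

theorem core2 {a₁ b₁ a₂ b₂ x y z : V} (L : G.Walk a₁ z) (A₁ : G.Walk z x) (B₁ : G.Walk x b₁)
    (A : G.Walk a₂ z) (C : G.Walk z y) (D : G.Walk y b₂) (S : G.Walk x y)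
    (hS : S.IsPath) (hxz : x ≠ z) (hyz : y ≠ z) (hxy : x ≠ y)
    (hR : ∀ v, v ∈ (A₁.append B₁).support → v ∈ (A.append (C.append D)).support → v = z)
    (hS1 : ∀ v, v ∈ S.support → v ∈ (L.append (A₁.append B₁)).support → v = x)
    (hS2 : ∀ v, v ∈ S.support → v ∈ (A.append (C.append D)).support → v = y)
    (hD : ∀ v, v ∈ D.support → v ∈ (L.append (A₁.append B₁)).support → v = z)
    (h1 : IsLongestPath G (L.append (A₁.append B₁)))
    (h2 : IsLongestPath G (A.append (C.append D))) : False := by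
  obtain ⟨p1, m1⟩ := h1
  obtain ⟨p2, m2⟩ := h2
  have k1 := m1 _ _ (L.append (A₁.append (S.append D)))
  have k2 := m2 _ _ (A.append (C.append (S.reverse.append B₁)))
  have hs : S.length ≠ 0 := fun h => hxy (eq_of_length_eq_zero h)
  have hSr := hS.reverse
  simp only [isPath_append_iff', mem_support_append_iff, length_append, length_reverse,
    support_reverse, List.mem_reverse] at *
  have k1' := k1 (by
    have e1 := S.end_mem_support
    have e2 := C.end_mem_support
    have e3 := D.start_mem_support
    have e4 := C.start_mem_support
    have e5 := B₁.start_mem_support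
    have e6 := A₁.start_mem_support
    have e7 := A₁.end_mem_support
    have e8 := L.end_mem_support
    have e9 := A.end_mem_support
    have e10 := S.start_mem_support
    clear k1 k2 m1 m2
    grind)
  have k2' := k2 (by
    have e1 := S.end_mem_support
    have e2 := C.end_mem_support
    have e3 := D.start_mem_support
    have e4 := C.start_mem_support
    have e5 := B₁.start_mem_support
    have e6 := A₁.start_mem_support
    have e7 := A₁.end_mem_support
    have e8 := L.end_mem_support
    have e9 := A.end_mem_support
    have e10 := S.start_mem_support
    clear k1 k2 m1 m2
    grind)
  omega

theorem mem_infix_iff {u v w x : V} (X : G.Walk w u) (R : G.Walk u v) (Y : G.Walk v x) (t : V) :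
    t ∈ R.support ↔ ∃ i, X.length ≤ i ∧ i ≤ X.length + R.length ∧
      (X.append (R.append Y)).getVert i = t := by
  rw [mem_support_iff_exists_getVert]
  have key : ∀ n, n ≤ R.length →
      (X.append (R.append Y)).getVert (X.length + n) = R.getVert n := by
    intro n hn
    rw [getVert_append, if_neg (by omega), getVert_append]
    split_ifs with h
    · congr 1; omega
    · have : n = R.length := by omega
      subst this
      simp
  constructor
  · rintro ⟨n, rfl, hn⟩
    exact ⟨X.length + n, by omega, by omega, key n hn⟩
  · rintro ⟨i, h1, h2, rfl⟩
    obtain ⟨n, rfl⟩ := Nat.exists_eq_add_of_le h1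
    exact ⟨n, (key n (by omega)).symm, by omega⟩

/-- A subpath of a path containing `y` and one of `z`, the endpoints, contains one of the
segments from `z` to `y` or from `y` to the end. -/
theorem seg {a b c d y z : V} (A : G.Walk a z) (C : G.Walk z y) (D : G.Walk y b)
    (hp : (A.append (C.append D)).IsPath) (R : G.Walk c d)
    (hR : R.IsInfixOf (A.append (C.append D))) (hy : y ∈ R.support)
    (he : z ∈ R.support ∨ a ∈ R.support ∨ b ∈ R.support) :
    (∀ v ∈ C.support, v ∈ R.support) ∨ (∀ v ∈ D.support, v ∈ R.support) := by
  obtain ⟨X, Y, hXY⟩ := hR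
  have hinj := hp.getVert_injOn
  have hlen : (A.append (C.append D)).length = A.length + (C.length + D.length) := by simp
  have hlen2 : (A.append (C.append D)).length = X.length + (R.length + Y.length) := by
    rw [hXY]; simp
  have hRm : ∀ t, t ∈ R.support ↔ ∃ i, X.length ≤ i ∧ i ≤ X.length + R.length ∧
      (A.append (C.append D)).getVert i = t := by
    intro t; rw [hXY]; exact mem_infix_iff X R Y t
  have hCm := mem_infix_iff A C D
  have hDm : ∀ t, t ∈ D.support ↔ ∃ i, A.length + C.length ≤ i ∧
      i ≤ A.length + C.length + D.length ∧ (A.append (C.append D)).getVert i = t := by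
    intro t
    have := mem_infix_iff (A.append C) D nil t
    simpa [append_assoc] using this
  have hz : (A.append (C.append D)).getVert A.length = z := by
    simp [getVert_append]
  have hyv : (A.append (C.append D)).getVert (A.length + C.length) = y := by
    simp [getVert_append]
  have ha : (A.append (C.append D)).getVert 0 = a := getVert_zero _
  have hb : (A.append (C.append D)).getVert (A.length + (C.length + D.length)) = b := by
    rw [← hlen]; exact getVert_length _
  generalize A.append (C.append D) = P at *
  have inj : ∀ i j, i ≤ P.length → j ≤ P.length → P.getVert i = P.getVert j → i = j :=
    fun i j hi hj h => hinj hi hj h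
  rw [hRm] at hy
  obtain ⟨j, j1, j2, j3⟩ := hy
  have hj : j = A.length + C.length := inj _ _ (by omega) (by omega) (j3.trans hyv.symm)
  have left : ∀ i, i ≤ A.length → X.length ≤ i →
      (∀ v ∈ C.support, v ∈ R.support) := by
    intro i hi hi' v hv
    rw [hCm] at hv
    obtain ⟨k, k1, k2, k3⟩ := hv
    exact (hRm v).2 ⟨k, by omega, by omega, k3⟩
  rcases he with he | he | he
  · rw [hRm] at he
    obtain ⟨i, i1, i2, i3⟩ := he
    have : i = A.length := inj _ _ (by omega) (by omega) (i3.trans hz.symm)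
    exact Or.inl (left i (by omega) i1)
  · rw [hRm] at he
    obtain ⟨i, i1, i2, i3⟩ := he
    have : i = 0 := inj _ _ (by omega) (by omega) (i3.trans ha.symm)
    exact Or.inl (left i (by omega) i1)
  · rw [hRm] at he
    obtain ⟨i, i1, i2, i3⟩ := he
    have : i = A.length + (C.length + D.length) :=
      inj _ _ (by omega) (by omega) (i3.trans hb.symm)
    refine Or.inr fun v hv => ?_
    rw [hDm] at hv
    obtain ⟨k, k1, k2, k3⟩ := hv
    exact (hRm v).2 ⟨k, by omega, by omega, k3⟩

theorem exists_min (K : Set V) (X Y : Set V) : ∀ (m : ℕ) (x y : V) (S : G.Walk x y),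
    S.length = m → S.IsPath → (∀ v ∈ S.support, v ∈ K) → x ∈ X → y ∈ Y →
    ∃ (x' y' : V) (S' : G.Walk x' y'), S'.IsPath ∧ (∀ v ∈ S'.support, v ∈ K) ∧
      x' ∈ X ∧ y' ∈ Y ∧ (∀ v, v ∈ S'.support → v ∈ X → v = x') ∧
      (∀ v, v ∈ S'.support → v ∈ Y → v = y') := by
  classical
  intro m
  induction m using Nat.strong_induction_on with
  | _ m ih =>
    intro x y S hm hS hK hx hy
    by_cases hX : ∀ v, v ∈ S.support → v ∈ X → v = x
    · by_cases hY : ∀ v, v ∈ S.support → v ∈ Y → v = y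
      · exact ⟨x, y, S, hS, hK, hx, hy, hX, hY⟩
      · push Not at hY
        obtain ⟨v, hv, hvY, hne⟩ := hY
        refine ih (S.takeUntil v hv).length ?_ x v (S.takeUntil v hv) rfl (hS.takeUntil hv)
          (fun w hw => hK w (S.support_takeUntil_subset_support hv hw)) hx hvY
        have h1 := congrArg length (S.take_spec hv)
        rw [length_append] at h1
        have h2 : (S.dropUntil v hv).length ≠ 0 := fun h => hne (eq_of_length_eq_zero h)
        omega
    · push Not at hX
      obtain ⟨v, hv, hvX, hne⟩ := hX
      refine ih (S.dropUntil v hv).length ?_ v y (S.dropUntil v hv) rfl (hS.dropUntil hv)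
        (fun w hw => hK w (S.support_dropUntil_subset_support hv hw)) hvX hy
      have h1 := congrArg length (S.take_spec hv)
      rw [length_append] at h1
      have h2 : (S.takeUntil v hv).length ≠ 0 := fun h => hne (eq_of_length_eq_zero h).symm
      omega

theorem exists_connect {e f : V} (P : G.Walk e f) (X Y : Set V)
    (h1 : ∃ v, v ∈ P.support ∧ v ∈ X) (h2 : ∃ v, v ∈ P.support ∧ v ∈ Y) :
    ∃ (x' y' : V) (S' : G.Walk x' y'), S'.IsPath ∧ (∀ v ∈ S'.support, v ∈ P.support) ∧
      x' ∈ X ∧ y' ∈ Y ∧ (∀ v, v ∈ S'.support → v ∈ X → v = x') ∧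
      (∀ v, v ∈ S'.support → v ∈ Y → v = y') := by
  classical
  obtain ⟨x, hx, hxX⟩ := h1
  obtain ⟨y, hy, hyY⟩ := h2
  refine exists_min {v | v ∈ P.support} X Y _ x y
    ((P.takeUntil x hx).reverse.append (P.takeUntil y hy)).bypass rfl (bypass_isPath _) ?_ hxX hyY
  intro v hv
  have := support_bypass_subset_support _ hv
  rw [mem_support_append_iff, support_reverse, List.mem_reverse] at this
  rcases this with h | h
  · exact P.support_takeUntil_subset_support hx h
  · exact P.support_takeUntil_subset_support hy h

theorem infix_reverse {u v w x : V} {R : G.Walk u v} {P : G.Walk w x} (h : R.IsInfixOf P) :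
    R.reverse.IsInfixOf P.reverse := by
  obtain ⟨X, Y, rfl⟩ := h
  exact ⟨Y.reverse, X.reverse, by simp [append_assoc]⟩

theorem longest_reverse {a b : V} {P : G.Walk a b} (h : IsLongestPath G P) :
    IsLongestPath G P.reverse :=
  ⟨h.1.reverse, fun c d q hq => by rw [length_reverse]; exact h.2 c d q hq⟩

/-- The case where `y` lies after `z` on `P₂` and the subpath is oriented along `P₂`. -/
theorem main1 {a₁ b₁ a₂ b₂ x y z c d : V} (L : G.Walk a₁ z) (R₁ : G.Walk z b₁)
    (A : G.Walk a₂ z) (B : G.Walk z b₂) (S : G.Walk x y) (R : G.Walk c d)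
    (hx : x ∈ R₁.support) (hy : y ∈ B.support) (hyR : y ∈ R.support)
    (hRi : R.IsInfixOf (A.append B))
    (he : z ∈ R.support ∨ a₂ ∈ R.support ∨ b₂ ∈ R.support)
    (hS : S.IsPath) (hxz : x ≠ z) (hyz : y ≠ z) (hxy : x ≠ y)
    (hR : ∀ v, v ∈ R₁.support → v ∈ (A.append B).support → v = z)
    (hS1 : ∀ v, v ∈ S.support → v ∈ (L.append R₁).support → v = x)
    (hS2 : ∀ v, v ∈ S.support → v ∈ (A.append B).support → v = y)
    (hint : ∀ v, v ∈ R.support → v ∈ (L.append R₁).support → v = z)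
    (h1 : IsLongestPath G (L.append R₁))
    (h2 : IsLongestPath G (A.append B)) : False := by
  classical
  obtain ⟨A₁, B₁, rfl⟩ : ∃ (A₁ : G.Walk z x) (B₁ : G.Walk x b₁), R₁ = A₁.append B₁ :=
    ⟨_, _, (R₁.take_spec hx).symm⟩
  obtain ⟨C, D, rfl⟩ : ∃ (C : G.Walk z y) (D : G.Walk y b₂), B = C.append D :=
    ⟨_, _, (B.take_spec hy).symm⟩
  rcases seg A C D h2.1 R hRi hyR he with h | h
  · exact core1 L A₁ B₁ A C D S hS hxz hyz hxy hR hS1 hS2 (fun v hv => hint v (h v hv)) h1 h2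
  · exact core2 L A₁ B₁ A C D S hS hxz hyz hxy hR hS1 hS2 (fun v hv => hint v (h v hv)) h1 h2

/-- Arbitrary position of `y` on `P₂`. -/
theorem main2 {a₁ b₁ a₂ b₂ x y z c d : V} (L : G.Walk a₁ z) (R₁ : G.Walk z b₁)
    (P₂ : G.Walk a₂ b₂) (hz : z ∈ P₂.support) (S : G.Walk x y) (R : G.Walk c d)
    (hx : x ∈ R₁.support) (hy : y ∈ P₂.support) (hyR : y ∈ R.support)
    (hRi : R.IsInfixOf P₂)
    (he : z ∈ R.support ∨ a₂ ∈ R.support ∨ b₂ ∈ R.support)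
    (hS : S.IsPath) (hxz : x ≠ z) (hyz : y ≠ z) (hxy : x ≠ y)
    (hR : ∀ v, v ∈ R₁.support → v ∈ P₂.support → v = z)
    (hS1 : ∀ v, v ∈ S.support → v ∈ (L.append R₁).support → v = x)
    (hS2 : ∀ v, v ∈ S.support → v ∈ P₂.support → v = y)
    (hint : ∀ v, v ∈ R.support → v ∈ (L.append R₁).support → v = z)
    (h1 : IsLongestPath G (L.append R₁))
    (h2 : IsLongestPath G P₂) : False := by
  classical
  obtain ⟨A, B, rfl⟩ : ∃ (A : G.Walk a₂ z) (B : G.Walk z b₂), P₂ = A.append B :=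
    ⟨_, _, (P₂.take_spec hz).symm⟩
  rw [mem_support_append_iff] at hy
  rcases hy with hy | hy
  · have hrev : (A.append B).reverse = B.reverse.append A.reverse := reverse_append _ _
    have hsup : ∀ v, v ∈ (B.reverse.append A.reverse).support ↔ v ∈ (A.append B).support := by
      intro v; rw [← hrev, support_reverse, List.mem_reverse]
    refine main1 L R₁ B.reverse A.reverse S R.reverse hx (by simpa using hy) (by simpa using hyR)
      (hrev ▸ infix_reverse hRi) ?_ hS hxz hyz hxy (fun v a b => hR v a ((hsup v).1 b)) hS1
      (fun v a b => hS2 v a ((hsup v).1 b)) (fun v a b => hint v (by simpa using a) b) h1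
      (hrev ▸ longest_reverse h2)
    simp only [support_reverse, List.mem_reverse]
    tauto
  · exact main1 L R₁ A B S R hx hy hyR hRi he hS hxz hyz hxy hR hS1 hS2 hint h1 h2

/-- The tail is, up to reversing `P₁`, a suffix. -/
theorem tail_cases {a b d z : V} (P : G.Walk a b) (hP : P.IsPath) (R : G.Walk z d)
    (h : IsTailFrom z R P) :
    (d = z ∧ ∀ v ∈ R.support, v = z) ∨ (∃ L : G.Walk a z, ∃ hb : d = b, P = L.append (R.copy rfl hb)) ∨
      (∃ L : G.Walk b z, ∃ hb : d = a, P.reverse = L.append (R.copy rfl hb)) := by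
  rcases h with ⟨⟨hu, Q, h⟩, hv⟩ | ⟨⟨hv, Q, h⟩, -⟩ | ⟨⟨hu, Q, h⟩, -⟩ | ⟨⟨hv, Q, h⟩, hz⟩
  · left
    subst hu hv h
    have := hP.of_append_left
    rw [copy_rfl_rfl, isPath_iff_eq_nil] at this
    subst this
    simp
  · exact Or.inr (Or.inl ⟨Q, hv, h⟩)
  · right; right
    subst hu
    refine ⟨Q.reverse, rfl, ?_⟩
    rw [h]
    simp
  · left
    subst hz hv h
    have := hP.of_append_right
    rw [copy_rfl_rfl, isPath_reverse_iff, isPath_iff_eq_nil] at this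
    subst this
    simp

end LongestAux

/-- Paths `P₁`, `P₂` sharing a vertex `z`, with `R₁` a tail of `P₁` starting at `z`, and
`R₂` a union of pairwise internally vertex-disjoint subpaths `Q i` of `P₂`, each having as
one endpoint either `z` or an endpoint of `P₂`, such that `R₁ ∩ P₂ = {z}` and
`R₂ ∩ P₁ ⊆ {z}`, cannot both be longest paths if there is a connecting path `P` avoiding
`z` that meets `P₁` in a nonempty set of vertices inside `R₁` and meets `P₂` in a nonempty
set of vertices inside `R₂`. -/
theorem not_both_longest_of_connecting_path'' {V : Type} [Fintype V] {G : SimpleGraph V}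
    {a₁ b₁ a₂ b₂ d₁ e f z : V}
    (P₁ : G.Walk a₁ b₁) (P₂ : G.Walk a₂ b₂) (hP₁ : P₁.IsPath) (hP₂ : P₂.IsPath)
    (hz₁ : z ∈ P₁.support) (hz₂ : z ∈ P₂.support)
    -- `R₁` is a tail of `P₁` starting at `z`
    (R₁ : G.Walk z d₁) (hR₁ : SimpleGraph.Walk.IsTailFrom z R₁ P₁)
    -- `R₂` is the union of the subpaths `Q 0, …, Q (n-1)` of `P₂`
    {n : ℕ} (c d : Fin n → V) (Q : ∀ i : Fin n, G.Walk (c i) (d i))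
    (hQsub : ∀ i, (Q i).IsSubpathOf P₂)
    -- the subpaths are pairwise internally vertex disjoint (they may share endpoints)
    (hQdisj : ∀ i j, i ≠ j → ∀ v, v ∈ (Q i).support → v ∈ (Q j).support →
      (v = c i ∨ v = d i) ∧ (v = c j ∨ v = d j))
    -- each subpath has as one endpoint `z` or an endpoint of `P₂`
    (hQend : ∀ i, c i = z ∨ c i = a₂ ∨ c i = b₂ ∨ d i = z ∨ d i = a₂ ∨ d i = b₂)
    (hint₁ : {v : V | v ∈ R₁.support ∧ v ∈ P₂.support} = {z})
    (hint₂ : ∀ v, (∃ i, v ∈ (Q i).support) → v ∈ P₁.support → v = z)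
    (P : G.Walk e f) (hP : P.IsPath) (hzP : z ∉ P.support)
    (hne₁ : ∃ v, v ∈ P.support ∧ v ∈ P₁.support)
    (hsub₁ : ∀ v, v ∈ P.support → v ∈ P₁.support → v ∈ R₁.support)
    (hne₂ : ∃ v, v ∈ P.support ∧ v ∈ P₂.support)
    (hsub₂ : ∀ v, v ∈ P.support → v ∈ P₂.support → ∃ i, v ∈ (Q i).support) :
    ¬ (IsLongestPath G P₁ ∧ IsLongestPath G P₂) := by
  rintro ⟨h1, h2⟩
  obtain ⟨x, y, S, hS, hSP, hx, hy, hS1, hS2⟩ := LongestAux.exists_connect P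
    {v | v ∈ P₁.support} {v | v ∈ P₂.support} hne₁ hne₂
  simp only [Set.mem_setOf_eq] at hx hy hS1 hS2
  have hxP := hSP x S.start_mem_support
  have hyP := hSP y S.end_mem_support
  have hxz : x ≠ z := fun h => hzP (h ▸ hxP)
  have hyz : y ≠ z := fun h => hzP (h ▸ hyP)
  have hxR := hsub₁ x hxP hx
  obtain ⟨i, hyQ⟩ := hsub₂ y hyP hy
  have hxy : x ≠ y := by
    rintro rfl
    exact hxz (hint₂ x ⟨i, hyQ⟩ hx)
  have hR : ∀ v, v ∈ R₁.support → v ∈ P₂.support → v = z := by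
    intro v a b
    have : v ∈ {v : V | v ∈ R₁.support ∧ v ∈ P₂.support} := ⟨a, b⟩
    rw [hint₁] at this
    exact this
  have hint : ∀ v, v ∈ (Q i).support → v ∈ P₁.support → v = z := fun v hv => hint₂ v ⟨i, hv⟩
  have he : z ∈ (Q i).support ∨ a₂ ∈ (Q i).support ∨ b₂ ∈ (Q i).support := by
    have hc := (Q i).start_mem_support
    have hd := (Q i).end_mem_support
    rcases hQend i with h | h | h | h | h | h
    · exact Or.inl (h ▸ hc)
    · exact Or.inr (Or.inl (h ▸ hc))
    · exact Or.inr (Or.inr (h ▸ hc))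
    · exact Or.inl (h ▸ hd)
    · exact Or.inr (Or.inl (h ▸ hd))
    · exact Or.inr (Or.inr (h ▸ hd))
  -- orient the subpath along `P₂`
  obtain ⟨c', d', R, hRi, hRs⟩ : ∃ (c' d' : V) (R : G.Walk c' d'), R.IsInfixOf P₂ ∧
      ∀ v, v ∈ R.support ↔ v ∈ (Q i).support := by
    rcases hQsub i with h | h
    · exact ⟨_, _, Q i, h, fun v => Iff.rfl⟩
    · exact ⟨_, _, (Q i).reverse, h, fun v => by simp⟩
  simp only [← hRs] at he hint hyQ
  rcases LongestAux.tail_cases P₁ hP₁ R₁ hR₁ with ⟨-, h⟩ | ⟨L, rfl, h⟩ | ⟨L, rfl, h⟩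
  · exact hxz (h x hxR)
  · rw [SimpleGraph.Walk.copy_rfl_rfl] at h
    subst h
    exact LongestAux.main2 L R₁ P₂ hz₂ S R hxR hy hyQ hRi he hS hxz hyz hxy hR hS1 hS2 hint h1 h2
  · rw [SimpleGraph.Walk.copy_rfl_rfl] at h
    have hsup : ∀ v, v ∈ (L.append R₁).support ↔ v ∈ P₁.support := by
      intro v; rw [← h]; simp
    exact LongestAux.main2 L R₁ P₂ hz₂ S R hxR hy hyQ hRi he hS hxz hyz hxy hR
      (fun v a b => hS1 v a ((hsup v).1 b)) hS2 (fun v a b => hint v a ((hsup v).1 b))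
      (h ▸ LongestAux.longest_reverse h1) h2
end

section
/- Let G be a finite connected series-parallel graph, let T be a 2-tree on the same vertex set containing G as a spanning subgraph, and let Δ = {v1, v2, v3} be a triangle of T. If for each i in {1,2,3}, R_i is a path in G having v_i as an endpoint and whose vertex intersection with Δ equals {v_i}, then at most one of the three sets R1∩R2, R1∩R3, R2∩R3 is nonempty. -/
open SimpleGraph

/-- The graph obtained from `G` by adding one new vertex adjacent exactly to `x` and `y`. -/
def SimpleGraph.addLink2 {V : Type u} (G : SimpleGraph V) (x y : V) :
    SimpleGraph (Option V) :=
  SimpleGraph.fromRel (fun a b =>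
    (∃ u w : V, a = some u ∧ b = some w ∧ G.Adj u w) ∨
    (a = none ∧ (b = some x ∨ b = some y)))

/-- Skeletons of 2-trees: `K₂` is a 2-tree, and adding a new vertex adjacent exactly to the
two endpoints of an edge of a 2-tree yields a 2-tree. -/
inductive IsTwoTreeSkel : (W : Type u) → SimpleGraph W → Prop
  | base : IsTwoTreeSkel (ULift (Fin 2)) ⊤
  | extend {W : Type u} {G : SimpleGraph W} {x y : W} :
      IsTwoTreeSkel W G → G.Adj x y → IsTwoTreeSkel (Option W) (G.addLink2 x y)

/-- A graph is a 2-tree if it is isomorphic to a 2-tree skeleton. -/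
def IsTwoTree {V : Type u} (G : SimpleGraph V) : Prop :=
  ∃ (W : Type u) (H : SimpleGraph W), IsTwoTreeSkel W H ∧ Nonempty (G ≃g H)

/-- Every triangle admits a labelling of the other vertices by a corner that they (and their
neighbours off the triangle) are not adjacent to. -/
def TriSep {W : Type u} (T : SimpleGraph W) : Prop :=
  ∀ a b c : W, T.Adj a b → T.Adj a c → T.Adj b c → ∃ f : W → W,
    (∀ u, u ≠ a → u ≠ b → u ≠ c → (f u = a ∨ f u = b ∨ f u = c) ∧ ¬ T.Adj u (f u)) ∧
    (∀ u w, u ≠ a → u ≠ b → u ≠ c → w ≠ a → w ≠ b → w ≠ c → T.Adj u w → f u = f w)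

theorem addLink2_some_some {W : Type u} (T : SimpleGraph W) (x y u w : W) :
    (T.addLink2 x y).Adj (some u) (some w) ↔ T.Adj u w := by
  simp only [SimpleGraph.addLink2, SimpleGraph.fromRel_adj]
  constructor
  · rintro ⟨-, (⟨u', w', h1, h2, h⟩ | ⟨h, -⟩) | (⟨u', w', h1, h2, h⟩ | ⟨h, -⟩)⟩
    · cases h1; cases h2; exact h
    · cases h
    · cases h1; cases h2; exact h.symm
    · cases h
  · intro h
    exact ⟨fun e => h.ne (Option.some.inj e), Or.inl (Or.inl ⟨u, w, rfl, rfl, h⟩)⟩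

theorem addLink2_none_some {W : Type u} (T : SimpleGraph W) (x y u : W) :
    (T.addLink2 x y).Adj none (some u) ↔ (u = x ∨ u = y) := by
  simp [SimpleGraph.addLink2, SimpleGraph.fromRel_adj]

theorem addLink2_some_none {W : Type u} (T : SimpleGraph W) (x y u : W) :
    (T.addLink2 x y).Adj (some u) none ↔ (u = x ∨ u = y) := by
  rw [SimpleGraph.adj_comm, addLink2_none_some]

theorem triSep_extend_old {W : Type u} {T : SimpleGraph W} (x y a b c : W) (hxy : T.Adj x y)
    (hT : TriSep T) (hab : T.Adj a b) (hac : T.Adj a c) (hbc : T.Adj b c) :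
    ∃ g : W, (g = a ∨ g = b ∨ g = c) ∧ g ≠ x ∧ g ≠ y ∧ ∃ f : W → W,
    (∀ u, u ≠ a → u ≠ b → u ≠ c → (f u = a ∨ f u = b ∨ f u = c) ∧ ¬ T.Adj u (f u)) ∧
    (∀ u w, u ≠ a → u ≠ b → u ≠ c → w ≠ a → w ≠ b → w ≠ c → T.Adj u w → f u = f w) ∧
    (∀ u, (u = x ∨ u = y) → u ≠ a → u ≠ b → u ≠ c → f u = g) := by
  obtain ⟨f, h1, h2⟩ := hT a b c hab hac hbc
  by_cases hx : x = a ∨ x = b ∨ x = c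
  · by_cases hy : y = a ∨ y = b ∨ y = c
    · have hne := hab.ne
      have hne2 := hac.ne
      have hne3 := hbc.ne
      have : ∃ g : W, (g = a ∨ g = b ∨ g = c) ∧ g ≠ x ∧ g ≠ y := by
        by_cases ha : a ≠ x ∧ a ≠ y
        · exact ⟨a, by simp, ha⟩
        by_cases hb : b ≠ x ∧ b ≠ y
        · exact ⟨b, by simp, hb⟩
        refine ⟨c, by simp, ?_⟩
        grind
      obtain ⟨g, hg, hgx, hgy⟩ := this
      exact ⟨g, hg, hgx, hgy, f, h1, h2, by grind⟩
    · push Not at hy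
      obtain ⟨ya, yb, yc⟩ := hy
      have := h1 y ya yb yc
      refine ⟨f y, this.1, ?_, ?_, f, h1, h2, by grind⟩
      · intro e; exact this.2 (e ▸ hxy.symm)
      · intro e; grind
  · push Not at hx
    obtain ⟨xa, xb, xc⟩ := hx
    have := h1 x xa xb xc
    refine ⟨f x, this.1, ?_, ?_, f, h1, h2, ?_⟩
    · intro e; grind
    · intro e; exact this.2 (e ▸ hxy)
    · rintro u (rfl | rfl) ha hb hc
      · rfl
      · exact (h2 _ _ xa xb xc ha hb hc hxy).symm

theorem triSep_extend {W : Type u} {T : SimpleGraph W} {x y : W} (hxy : T.Adj x y)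
    (hT : TriSep T) : TriSep (T.addLink2 x y) := by
  intro a b c hab hac hbc
  by_cases hn : a = none ∨ b = none ∨ c = none
  · refine ⟨fun _ => none, ?_, fun _ _ _ _ _ _ _ _ _ => rfl⟩
    intro u ha hb hc
    refine ⟨by grind, ?_⟩
    rcases u with _ | u
    · grind
    rw [addLink2_some_none]
    rcases a with _ | a <;> rcases b with _ | b <;> rcases c with _ | c <;>
      simp only [addLink2_some_some, addLink2_none_some, addLink2_some_none,
        SimpleGraph.irrefl] at hab hac hbc
    all_goals grind [SimpleGraph.irrefl]
  · push Not at hn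
    obtain ⟨ha, hb, hc⟩ := hn
    obtain ⟨a, rfl⟩ := Option.ne_none_iff_exists'.mp ha
    obtain ⟨b, rfl⟩ := Option.ne_none_iff_exists'.mp hb
    obtain ⟨c, rfl⟩ := Option.ne_none_iff_exists'.mp hc
    rw [addLink2_some_some] at hab hac hbc
    obtain ⟨g, hg, hgx, hgy, f, h1, h2, h3⟩ := triSep_extend_old x y a b c hxy hT hab hac hbc
    refine ⟨fun u => some (u.elim g f), ?_, ?_⟩
    · rintro (_ | u) ua ub uc
      · simp only [Option.elim, addLink2_none_some, Option.some.injEq]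
        exact ⟨hg, not_or.2 ⟨hgx, hgy⟩⟩
      · simp only [ne_eq, Option.some.injEq] at ua ub uc
        simp only [Option.elim, addLink2_some_some, Option.some.injEq]
        exact h1 u ua ub uc
    · rintro (_ | u) (_ | w) ua ub uc wa wb wc huw
      · rfl
      · rw [addLink2_none_some] at huw
        simp only [ne_eq, Option.some.injEq] at wa wb wc
        exact congrArg some (h3 w huw wa wb wc).symm
      · rw [addLink2_some_none] at huw
        simp only [ne_eq, Option.some.injEq] at ua ub uc
        exact congrArg some (h3 u huw ua ub uc)
      · rw [addLink2_some_some] at huw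
        simp only [ne_eq, Option.some.injEq] at ua ub uc wa wb wc
        exact congrArg some (h2 u w ua ub uc wa wb wc huw)

theorem triSep_skel {W : Type u} {T : SimpleGraph W} (h : IsTwoTreeSkel W T) : TriSep T := by
  induction h with
  | base =>
    rintro ⟨a⟩ ⟨b⟩ ⟨c⟩ hab hac hbc
    have h1 := hab.ne
    have h2 := hac.ne
    have h3 := hbc.ne
    simp only [ne_eq, ULift.up.injEq] at h1 h2 h3
    omega
  | extend _ hxy ih => exact triSep_extend hxy ih

theorem triSep_twoTree {V : Type u} {T : SimpleGraph V} (h : IsTwoTree T) : TriSep T := by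
  obtain ⟨W, H, hH, ⟨e⟩⟩ := h
  intro a b c hab hac hbc
  obtain ⟨f, h1, h2⟩ := triSep_skel hH (e a) (e b) (e c) (e.map_adj_iff.2 hab)
    (e.map_adj_iff.2 hac) (e.map_adj_iff.2 hbc)
  refine ⟨fun u => e.symm (f (e u)), ?_, ?_⟩
  · intro u ha hb hc
    obtain ⟨h3, h4⟩ := h1 (e u) (e.injective.ne ha) (e.injective.ne hb) (e.injective.ne hc)
    refine ⟨?_, ?_⟩
    · rcases h3 with h3 | h3 | h3 <;> simp [h3]
    · rw [← e.map_adj_iff]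
      simpa using h4
  · intro u w ha hb hc ha' hb' hc' huw
    exact congrArg e.symm (h2 _ _ (e.injective.ne ha) (e.injective.ne hb) (e.injective.ne hc)
      (e.injective.ne ha') (e.injective.ne hb') (e.injective.ne hc') (e.map_adj_iff.2 huw))

/-- A function constant on edges outside a set is constant along a walk outside that set. -/
theorem walk_const {V : Type u} {G : SimpleGraph V} (S : V → Prop) (f : V → V)
    (hf : ∀ u w, ¬ S u → ¬ S w → G.Adj u w → f u = f w) {v t : V} (p : G.Walk v t)
    (hp : ∀ u ∈ p.support, ¬ S u) : ∀ u ∈ p.support, f u = f v := by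
  induction p with
  | nil => intro u hu; simp at hu; rw [hu]
  | cons h p ih =>
    intro u hu
    rw [SimpleGraph.Walk.support_cons, List.mem_cons] at hu
    rcases hu with rfl | hu
    · rfl
    · rw [ih (fun w hw => hp w (by simp [hw])) u hu]
      exact (hf _ _ (hp _ (by simp)) (hp _ (by simp)) h).symm

theorem path_label {V : Type u} {G : SimpleGraph V} (S : V → Prop) (f : V → V)
    (hf : ∀ u w, ¬ S u → ¬ S w → G.Adj u w → f u = f w) {v t : V}
    (hv : ∀ u, ¬ S u → G.Adj u v → f u ≠ v) (p : G.Walk v t) (hpath : p.IsPath)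
    (hp : ∀ u ∈ p.support, u ≠ v → ¬ S u) :
    ∃ c, ∀ u ∈ p.support, u ≠ v → f u = c ∧ c ≠ v := by
  cases p with
  | nil => exact ⟨v, fun u hu hne => absurd (by simpa using hu) hne⟩
  | @cons _ w _ h p =>
    rw [SimpleGraph.Walk.cons_isPath_iff] at hpath
    have key : ∀ u ∈ p.support, ¬ S u := fun u hu =>
      hp u (by simp [hu]) (fun e => hpath.2 (e ▸ hu))
    refine ⟨f w, fun u hu hne => ⟨?_, hv w (key w (by simp)) h.symm⟩⟩
    rw [SimpleGraph.Walk.support_cons, List.mem_cons] at hu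
    exact walk_const S f hf p key u (hu.resolve_left hne)

/-- Let `G` be a connected series-parallel graph, spanning subgraph of a 2-tree `T`, and
let `{v₁, v₂, v₃}` be a triangle of `T`.  If `Rᵢ` is a path of `G` with endpoint `vᵢ`
meeting the triangle only in `vᵢ` (for `i = 1, 2, 3`), then at most one of the pairwise
vertex intersections `R₁ ∩ R₂`, `R₁ ∩ R₃`, `R₂ ∩ R₃` is nonempty. -/
theorem at_most_one_pair_intersects {V : Type} [Fintype V] (G T : SimpleGraph V)
    (hGT : G ≤ T) (hT : IsTwoTree T) (hconn : G.Connected)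
    (v₁ v₂ v₃ : V) (h12 : v₁ ≠ v₂) (h13 : v₁ ≠ v₃) (h23 : v₂ ≠ v₃)
    (hadj12 : T.Adj v₁ v₂) (hadj13 : T.Adj v₁ v₃) (hadj23 : T.Adj v₂ v₃)
    {t₁ t₂ t₃ : V} (R₁ : G.Walk v₁ t₁) (R₂ : G.Walk v₂ t₂) (R₃ : G.Walk v₃ t₃)
    (hR₁ : R₁.IsPath) (hR₂ : R₂.IsPath) (hR₃ : R₃.IsPath)
    (hR₁Δ : v₂ ∉ R₁.support ∧ v₃ ∉ R₁.support)
    (hR₂Δ : v₁ ∉ R₂.support ∧ v₃ ∉ R₂.support)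
    (hR₃Δ : v₁ ∉ R₃.support ∧ v₂ ∉ R₃.support) :
    ¬ ((∃ v, v ∈ R₁.support ∧ v ∈ R₂.support) ∧ (∃ v, v ∈ R₁.support ∧ v ∈ R₃.support)) ∧
    ¬ ((∃ v, v ∈ R₁.support ∧ v ∈ R₂.support) ∧ (∃ v, v ∈ R₂.support ∧ v ∈ R₃.support)) ∧
    ¬ ((∃ v, v ∈ R₁.support ∧ v ∈ R₃.support) ∧ (∃ v, v ∈ R₂.support ∧ v ∈ R₃.support)) := by
  obtain ⟨f, hf1, hf2⟩ := triSep_twoTree hT v₁ v₂ v₃ hadj12 hadj13 hadj23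
  have hconst : ∀ u w, ¬ (u = v₁ ∨ u = v₂ ∨ u = v₃) → ¬ (w = v₁ ∨ w = v₂ ∨ w = v₃) →
      G.Adj u w → f u = f w := by
    intro u w hu hw huw
    push Not at hu hw
    exact hf2 u w hu.1 hu.2.1 hu.2.2 hw.1 hw.2.1 hw.2.2 (hGT huw)
  have hmiss : ∀ v u, ¬ (u = v₁ ∨ u = v₂ ∨ u = v₃) → G.Adj u v → f u ≠ v := by
    intro v u hu huv e
    push Not at hu
    exact (hf1 u hu.1 hu.2.1 hu.2.2).2 (e.symm ▸ hGT huv)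
  obtain ⟨c₁, hc₁⟩ := path_label (fun u => u = v₁ ∨ u = v₂ ∨ u = v₃) f hconst (hmiss v₁) R₁ hR₁
    (by grind)
  obtain ⟨c₂, hc₂⟩ := path_label (fun u => u = v₁ ∨ u = v₂ ∨ u = v₃) f hconst (hmiss v₂) R₂ hR₂
    (by grind)
  obtain ⟨c₃, hc₃⟩ := path_label (fun u => u = v₁ ∨ u = v₂ ∨ u = v₃) f hconst (hmiss v₃) R₃ hR₃
    (by grind)
  have hmem : ∀ u, u ≠ v₁ → u ≠ v₂ → u ≠ v₃ → f u = v₁ ∨ f u = v₂ ∨ f u = v₃ :=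
    fun u h1 h2 h3 => (hf1 u h1 h2 h3).1
  clear hf1 hf2 hconst hmiss
  have i12 : ∀ x, x ∈ R₁.support → x ∈ R₂.support →
      c₁ = c₂ ∧ c₁ ≠ v₁ ∧ c₁ ≠ v₂ ∧ (c₁ = v₁ ∨ c₁ = v₂ ∨ c₁ = v₃) := by
    intro x h1 h2
    have n1 : x ≠ v₁ := fun e => hR₂Δ.1 (e ▸ h2)
    have n2 : x ≠ v₂ := fun e => hR₁Δ.1 (e ▸ h1)
    have n3 : x ≠ v₃ := fun e => hR₁Δ.2 (e ▸ h1)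
    have := hc₁ x h1 n1
    have := hc₂ x h2 n2
    have := hmem x n1 n2 n3
    grind
  have i13 : ∀ x, x ∈ R₁.support → x ∈ R₃.support →
      c₁ = c₃ ∧ c₁ ≠ v₁ ∧ c₁ ≠ v₃ ∧ (c₁ = v₁ ∨ c₁ = v₂ ∨ c₁ = v₃) := by
    intro x h1 h2
    have n1 : x ≠ v₁ := fun e => hR₃Δ.1 (e ▸ h2)
    have n2 : x ≠ v₂ := fun e => hR₁Δ.1 (e ▸ h1)
    have n3 : x ≠ v₃ := fun e => hR₁Δ.2 (e ▸ h1)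
    have := hc₁ x h1 n1
    have := hc₃ x h2 n3
    have := hmem x n1 n2 n3
    grind
  have i23 : ∀ x, x ∈ R₂.support → x ∈ R₃.support →
      c₂ = c₃ ∧ c₂ ≠ v₂ ∧ c₂ ≠ v₃ ∧ (c₂ = v₁ ∨ c₂ = v₂ ∨ c₂ = v₃) := by
    intro x h1 h2
    have n1 : x ≠ v₁ := fun e => hR₃Δ.1 (e ▸ h2)
    have n2 : x ≠ v₂ := fun e => hR₃Δ.2 (e ▸ h2)
    have n3 : x ≠ v₃ := fun e => hR₂Δ.2 (e ▸ h1)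
    have := hc₂ x h1 n2
    have := hc₃ x h2 n3
    have := hmem x n1 n2 n3
    grind
  refine ⟨?_, ?_, ?_⟩
  · rintro ⟨⟨x, hx1, hx2⟩, ⟨y, hy1, hy2⟩⟩
    have := i12 x hx1 hx2
    have := i13 y hy1 hy2
    grind
  · rintro ⟨⟨x, hx1, hx2⟩, ⟨y, hy1, hy2⟩⟩
    have := i12 x hx1 hx2
    have := i23 y hy1 hy2
    grind
  · rintro ⟨⟨x, hx1, hx2⟩, ⟨y, hy1, hy2⟩⟩
    have := i13 x hx1 hx2
    have := i23 y hy1 hy2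
    grind
end

section
/- Let G be a finite connected series-parallel graph with at least one edge, and let T be a 2-tree on the same vertex set containing G as a spanning subgraph, with T not a single edge. Then there exists a triangle {u, v, w} of T such that every longest path of G contains at least one of u, v, w. -/
open SimpleGraph

/-- A vertex set is connected if every split into two nonempty parts is crossed by an edge. -/
def SplitConn {W : Type*} (T : SimpleGraph W) (S : Set W) : Prop :=
  ∀ A : Set W, (∃ a ∈ S, a ∈ A) → (∃ b ∈ S, b ∉ A) → ∃ a ∈ S, ∃ b ∈ S, a ∈ A ∧ b ∉ A ∧ T.Adj a b

/-- Two vertex sets touch if they meet or are joined by an edge. -/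
def Touch {W : Type*} (T : SimpleGraph W) (S S' : Set W) : Prop :=
  ∃ a ∈ S, ∃ b ∈ S', a = b ∨ T.Adj a b

/-- A family of nonempty connected pairwise touching sets. -/
def IsBramble {W : Type*} (T : SimpleGraph W) (F : Set (Set W)) : Prop :=
  (∀ S ∈ F, S.Nonempty ∧ SplitConn T S) ∧ ∀ S ∈ F, ∀ S' ∈ F, Touch T S S'

/-- Either a whole edge graph, or a triangle hitting the family. -/
def HasHit {W : Type*} (T : SimpleGraph W) (F : Set (Set W)) : Prop :=
  ∃ u v w : W, T.Adj u v ∧ ((∀ a, a = u ∨ a = v) ∨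
    (T.Adj u w ∧ T.Adj v w ∧ ∀ S ∈ F, u ∈ S ∨ v ∈ S ∨ w ∈ S))

theorem adj_some_some {W : Type*} {T : SimpleGraph W} {x y a b : W} :
    (T.addLink2 x y).Adj (some a) (some b) ↔ T.Adj a b := by
  simp only [SimpleGraph.addLink2, SimpleGraph.fromRel_adj]
  constructor
  · rintro ⟨-, h⟩
    simp at h
    exact h.elim id fun h => h.symm
  · intro h
    refine ⟨by simpa using h.ne, ?_⟩
    simp [h]

theorem adj_none_some {W : Type*} {T : SimpleGraph W} {x y b : W} :
    (T.addLink2 x y).Adj none (some b) ↔ b = x ∨ b = y := by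
  simp [SimpleGraph.addLink2, SimpleGraph.fromRel_adj]

theorem adj_some_none {W : Type*} {T : SimpleGraph W} {x y b : W} :
    (T.addLink2 x y).Adj (some b) none ↔ b = x ∨ b = y := by
  rw [SimpleGraph.adj_comm, adj_none_some]

theorem hit_step {W : Type*} {T : SimpleGraph W} {x y : W} (hxy : T.Adj x y)
    (ih : ∀ F, IsBramble T F → HasHit T F) (F : Set (Set (Option W)))
    (hF : IsBramble (T.addLink2 x y) F) : HasHit (T.addLink2 x y) F := by
  obtain ⟨hF1, hF2⟩ := hF
  -- the new triangle
  have newTri : (∀ S ∈ F, none ∈ S ∨ some x ∈ S ∨ some y ∈ S) →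
      HasHit (T.addLink2 x y) F := fun h =>
    ⟨none, some x, some y, adj_none_some.2 (Or.inl rfl),
      Or.inr ⟨adj_none_some.2 (Or.inr rfl), adj_some_some.2 hxy, h⟩⟩
  by_cases hs : ∃ S ∈ F, ∀ a, some a ∉ S
  · obtain ⟨S, hS, hno⟩ := hs
    apply newTri
    intro S' hS'
    obtain ⟨a, ha, b, hb, hab⟩ := hF2 S hS S' hS'
    rcases a with _ | a
    · rcases b with _ | b
      · exact Or.inl hb
      · rcases hab with h | h
        · simp at h
        · rcases adj_none_some.1 h with rfl | rfl <;> simp [hb]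
    · exact absurd ha (hno a)
  · push Not at hs
    -- a set containing the new vertex contains `x` or `y`
    have key : ∀ S ∈ F, none ∈ S → some x ∈ S ∨ some y ∈ S := by
      intro S hS hn
      obtain ⟨a, ha⟩ := hs S hS
      obtain ⟨c, hc, d, hd, hc', hd', hcd⟩ :=
        (hF1 S hS).2 {none} ⟨none, hn, rfl⟩ ⟨some a, ha, by simp⟩
      obtain rfl : c = none := hc'
      rcases d with _ | d
      · exact absurd rfl hd'
      · rcases adj_none_some.1 hcd with rfl | rfl <;> simp [hd]
    have hb : IsBramble T {S | ∃ R ∈ F, S = some ⁻¹' R} := by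
      constructor
      · rintro _ ⟨S, hS, rfl⟩
        refine ⟨hs S hS, ?_⟩
        rintro A ⟨a, ha, haA⟩ ⟨b, hb, hbA⟩
        obtain ⟨c, hc, d, hd, hcA, hdA, hcd⟩ := (hF1 S hS).2 (some '' A)
          ⟨some a, ha, by simpa using haA⟩ ⟨some b, hb, by simpa using hbA⟩
        obtain ⟨c', hc', d', hd', hcA', hdA', hcd'⟩ := (hF1 S hS).2 (insert none (some '' A))
          ⟨some a, ha, by simpa using haA⟩ ⟨some b, hb, by simpa using hbA⟩
        rcases c with _ | c
        · simp at hcA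
        rcases d' with _ | d'
        · simp at hdA'
        simp at hcA hdA'
        rcases d with _ | d
        · rcases c' with _ | c'
          · have h1 := adj_some_none.1 hcd
            have h2 := adj_none_some.1 hcd'
            refine ⟨c, hc, d', hd', hcA, hdA', ?_⟩
            rcases h1 with rfl | rfl <;> rcases h2 with rfl | rfl
            · exact absurd hcA hdA'
            · exact hxy
            · exact hxy.symm
            · exact absurd hcA hdA'
          · simp at hcA'
            exact ⟨c', hc', d', hd', hcA', hdA', adj_some_some.1 hcd'⟩
        · simp at hdA
          exact ⟨c, hc, d, hd, hcA, hdA, adj_some_some.1 hcd⟩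
      · rintro _ ⟨S, hS, rfl⟩ _ ⟨S', hS', rfl⟩
        have tt : ∀ p q, (p = x ∨ p = y) → (q = x ∨ q = y) → p = q ∨ T.Adj p q := by
          rintro p q (rfl | rfl) (rfl | rfl) <;> simp [hxy, hxy.symm]
        have k2 : ∀ R ∈ F, none ∈ R → ∃ p, (p = x ∨ p = y) ∧ some p ∈ R := by
          intro R hR hn
          rcases key R hR hn with h | h
          · exact ⟨x, Or.inl rfl, h⟩
          · exact ⟨y, Or.inr rfl, h⟩
        obtain ⟨a, ha, b, hb, hab⟩ := hF2 S hS S' hS'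
        rcases a with _ | a <;> rcases b with _ | b
        · obtain ⟨p, hp, hpS⟩ := k2 S hS ha
          obtain ⟨q, hq, hqS⟩ := k2 S' hS' hb
          exact ⟨p, hpS, q, hqS, tt p q hp hq⟩
        · obtain ⟨p, hp, hpS⟩ := k2 S hS ha
          rcases hab with h | h
          · simp at h
          exact ⟨p, hpS, b, hb, tt p b hp (adj_none_some.1 h)⟩
        · obtain ⟨q, hq, hqS⟩ := k2 S' hS' hb
          rcases hab with h | h
          · simp at h
          exact ⟨a, ha, q, hqS, tt a q (adj_some_none.1 h) hq⟩
        · refine ⟨a, ha, b, hb, ?_⟩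
          rcases hab with h | h
          · exact Or.inl (by simpa using h)
          · exact Or.inr (adj_some_some.1 h)
    obtain ⟨u, v, w, huv, h | ⟨huw, hvw, h⟩⟩ := ih _ hb
    · apply newTri
      intro S hS
      obtain ⟨a, ha⟩ := hs S hS
      have hne := hxy.ne
      rcases h x with h1 | h1 <;> rcases h y with h2 | h2 <;> rcases h a with h3 | h3 <;>
        subst_vars <;> simp_all
    · exact ⟨some u, some v, some w, adj_some_some.2 huv, Or.inr ⟨adj_some_some.2 huw,
        adj_some_some.2 hvw, fun S hS => h _ ⟨S, hS, rfl⟩⟩⟩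

theorem skel_hit {W : Type u} {H : SimpleGraph W} (h : IsTwoTreeSkel W H) :
    ∀ F, IsBramble H F → HasHit H F := by
  induction h with
  | base =>
    intro F _
    refine ⟨⟨0⟩, ⟨1⟩, ⟨0⟩, by simp, Or.inl ?_⟩
    rintro ⟨a⟩
    fin_cases a <;> simp
  | extend _ hxy ih => exact hit_step hxy ih

theorem splitConn_support {V : Type*} {G T : SimpleGraph V} (hGT : G ≤ T) {a b : V}
    (p : G.Walk a b) : SplitConn T {v | v ∈ p.support} := by
  classical
  rintro A ⟨c, hc, hcA⟩ ⟨d, hd, hdA⟩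
  simp only [Set.mem_setOf_eq] at *
  by_cases haA : a ∈ A
  · obtain ⟨e, he, h1, h2⟩ := (p.takeUntil d hd).exists_boundary_dart A haA hdA
    have hs := p.support_takeUntil_subset_support hd
    exact ⟨e.fst, hs (Walk.dart_fst_mem_support_of_mem_darts _ he), e.snd,
      hs (Walk.dart_snd_mem_support_of_mem_darts _ he), h1, h2, hGT e.adj⟩
  · obtain ⟨e, he, h1, h2⟩ := (p.takeUntil c hc).exists_boundary_dart Aᶜ haA (by simpa using hcA)
    have hs := p.support_takeUntil_subset_support hc
    exact ⟨e.snd, hs (Walk.dart_snd_mem_support_of_mem_darts _ he), e.fst,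
      hs (Walk.dart_fst_mem_support_of_mem_darts _ he), by simpa using h2, h1, hGT e.adj.symm⟩

theorem append_isPath {V : Type*} {G : SimpleGraph V} {a b c : V} {p : G.Walk a b}
    {q : G.Walk b c} (hp : p.IsPath) (hq : q.IsPath)
    (h : ∀ z ∈ p.support, z ∈ q.support → z = b) : (p.append q).IsPath := by
  rw [Walk.isPath_def, Walk.support_append]
  have hq' := hq.support_nodup
  rw [Walk.support_eq_cons] at hq'
  refine List.Nodup.append hp.support_nodup (List.nodup_cons.1 hq').2 ?_
  intro z hz hz'
  have := h z hz (List.mem_of_mem_tail hz')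
  subst this
  exact (List.nodup_cons.1 hq').1 hz'

theorem exists_half {V : Type*} {G : SimpleGraph V} {a b x : V} (p : G.Walk a b)
    (hp : p.IsPath) (hx : x ∈ p.support) :
    ∃ (c : V) (s : G.Walk c x), s.IsPath ∧ s.support ⊆ p.support ∧ p.length ≤ 2 * s.length := by
  classical
  have hl : (p.takeUntil x hx).length + (p.dropUntil x hx).length = p.length := by
    rw [← Walk.length_append, Walk.take_spec]
  by_cases h : (p.dropUntil x hx).length ≤ (p.takeUntil x hx).length
  · exact ⟨a, p.takeUntil x hx, hp.takeUntil hx, p.support_takeUntil_subset_support hx, by omega⟩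
  · refine ⟨b, (p.dropUntil x hx).reverse, (hp.dropUntil hx).reverse, ?_, ?_⟩
    · intro z hz
      rw [Walk.support_reverse, List.mem_reverse] at hz
      exact p.support_dropUntil_subset_support hx hz
    · rw [Walk.length_reverse]; omega

theorem longest_meet {V : Type*} {G : SimpleGraph V} (hG : G.Connected) {a b c d : V}
    {p : G.Walk a b} {q : G.Walk c d} (hp : IsLongestPath G p) (hq : IsLongestPath G q) :
    ∃ z, z ∈ p.support ∧ z ∈ q.support := by
  classical
  by_contra hcon
  push Not at hcon
  have hex : ∃ n, ∃ x ∈ p.support, ∃ y ∈ q.support, ∃ r : G.Walk x y, r.length = n := by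
    obtain ⟨r⟩ := hG.preconnected a c
    exact ⟨_, a, p.start_mem_support, c, q.start_mem_support, r, rfl⟩
  obtain ⟨x, hx, y, hy, r, hr⟩ := Nat.find_spec hex
  have hmin : ∀ x' ∈ p.support, ∀ y' ∈ q.support, ∀ r' : G.Walk x' y', r.length ≤ r'.length := by
    intro x' hx' y' hy' r'
    rw [hr]
    exact Nat.find_min' hex ⟨x', hx', y', hy', r', rfl⟩
  obtain ⟨r0, hr0, hr0l⟩ : ∃ r0 : G.Walk x y, r0.IsPath ∧ r0.length ≤ r.length :=
    ⟨r.bypass, r.bypass_isPath, r.length_bypass_le_length⟩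
  have hsplit : ∀ z (hz : z ∈ r0.support),
      (r0.takeUntil z hz).length + (r0.dropUntil z hz).length = r0.length := by
    intro z hz
    rw [← Walk.length_append, Walk.take_spec]
  have h1 : ∀ z ∈ r0.support, z ∈ p.support → z = x := by
    intro z hz hzp
    have := hmin z hzp y hy (r0.dropUntil z hz)
    have h2 := hsplit z hz
    exact (Walk.eq_of_length_eq_zero (p := r0.takeUntil z hz) (by omega)).symm
  have h2 : ∀ z ∈ r0.support, z ∈ q.support → z = y := by
    intro z hz hzq
    have := hmin x hx z hzq (r0.takeUntil z hz)
    have h2 := hsplit z hz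
    exact Walk.eq_of_length_eq_zero (p := r0.dropUntil z hz) (by omega)
  have hpos : r0.length ≠ 0 := by
    intro h
    have := Walk.eq_of_length_eq_zero h
    subst this
    exact hcon x hx hy
  obtain ⟨e, s, hs, hsp, hsl⟩ := exists_half p hp.1 hx
  obtain ⟨f, t, ht, htq, htl⟩ := exists_half q hq.1 hy
  have hsr : (s.append r0).IsPath := append_isPath hs hr0 fun z hz hz' => h1 z hz' (hsp hz)
  have hall : ((s.append r0).append t.reverse).IsPath := by
    refine append_isPath hsr ht.reverse ?_
    intro z hz hz'
    rw [Walk.support_reverse, List.mem_reverse] at hz'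
    rcases (Walk.mem_support_append_iff _ _).1 hz with h | h
    · exact absurd (htq hz') (hcon z (hsp h))
    · exact h2 z h (htq hz')
  have := hp.2 _ _ _ hall
  have h5 := hq.2 _ _ p hp.1
  have h6 := hp.2 _ _ q hq.1
  simp only [Walk.length_append, Walk.length_reverse] at this
  omega

/-- Let `G` be a connected series-parallel graph with at least one edge, spanning subgraph
of a 2-tree `T` which is not a single edge.  Then some triangle `{u, v, w}` of `T` is a
Gallai set for `G`: every longest path of `G` contains `u`, `v`, or `w`. -/
theorem exists_gallai_triangle {V : Type} [Fintype V] (G T : SimpleGraph V)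
    (hGT : G ≤ T) (hT : IsTwoTree T) (hconn : G.Connected)
    (hGedge : G.edgeSet.Nonempty) (hTbig : 3 ≤ Fintype.card V) :
    ∃ u v w : V, u ≠ v ∧ u ≠ w ∧ v ≠ w ∧ T.Adj u v ∧ T.Adj u w ∧ T.Adj v w ∧
      ∀ (a b : V) (p : G.Walk a b), IsLongestPath G p →
        u ∈ p.support ∨ v ∈ p.support ∨ w ∈ p.support := by
  obtain ⟨W, H, hH, ⟨e⟩⟩ := hT
  have hbr : IsBramble H {S | ∃ (a b : V) (p : G.Walk a b), IsLongestPath G p ∧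
      S = {z | e.symm z ∈ p.support}} := by
    constructor
    · rintro _ ⟨a, b, p, hp, rfl⟩
      refine ⟨⟨e a, by simp⟩, ?_⟩
      rintro A ⟨c, hc, hcA⟩ ⟨d, hd, hdA⟩
      obtain ⟨s, hs, t, ht, hsA, htA, hst⟩ := splitConn_support hGT p (e ⁻¹' A)
        ⟨e.symm c, hc, by simpa using hcA⟩ ⟨e.symm d, hd, by simpa using hdA⟩
      exact ⟨e s, by simpa using hs, e t, by simpa using ht, hsA, htA, e.map_adj_iff.2 hst⟩
    · rintro _ ⟨a, b, p, hp, rfl⟩ _ ⟨c, d, q, hq, rfl⟩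
      obtain ⟨z, hz1, hz2⟩ := longest_meet hconn hp hq
      exact ⟨e z, by simpa using hz1, e z, by simpa using hz2, Or.inl rfl⟩
  obtain ⟨u, v, w, huv, h | ⟨huw, hvw, h⟩⟩ := skel_hit hH _ hbr
  · exfalso
    classical
    have hsub : (Finset.univ : Finset V) ⊆ {e.symm u, e.symm v} := by
      intro z _
      rcases h (e z) with h | h
      · simp [← h]
      · simp [← h]
    have h1 := Finset.card_le_card hsub
    have h2 := Finset.card_le_two (a := e.symm u) (b := e.symm v)
    rw [Finset.card_univ] at h1
    omega
  · have e1 := e.symm.map_adj_iff.2 huv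
    have e2 := e.symm.map_adj_iff.2 huw
    have e3 := e.symm.map_adj_iff.2 hvw
    exact ⟨e.symm u, e.symm v, e.symm w, e1.ne, e2.ne, e3.ne, e1, e2, e3,
      fun a b p hp => h _ ⟨a, b, p, hp, rfl⟩⟩
end

section
/- Let G be a finite connected hypotraceable graph, that is, G has no Hamiltonian path but G − v has a Hamiltonian path for every vertex v of G. Then no vertex of G lies on all longest paths of G (i.e., the intersection of the vertex sets of all longest paths of G is empty). -/
open SimpleGraph

/-- A Hamiltonian path: a path visiting every vertex of the graph. -/
def IsHamPath {V : Type*} (G : SimpleGraph V) {a b : V} (p : G.Walk a b) : Prop :=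
  p.IsPath ∧ ∀ v : V, v ∈ p.support

/-- In a finite connected hypotraceable graph (no Hamiltonian path, but every vertex-deleted
subgraph has one), no vertex lies on all longest paths: the intersection of the vertex sets
of all longest paths is empty. -/
theorem hypotraceable_no_gallai_vertex {V : Type} [Fintype V] (G : SimpleGraph V)
    (hconn : G.Connected)
    (hnoham : ¬ ∃ (a b : V) (p : G.Walk a b), IsHamPath G p)
    (hhypo : ∀ v : V, ∃ (a b : {w : V // w ≠ v})
      (p : (G.induce {w : V | w ≠ v}).Walk a b), IsHamPath (G.induce {w : V | w ≠ v}) p) :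
    ∀ v : V, ∃ (a b : V) (p : G.Walk a b), IsLongestPath G p ∧ v ∉ p.support := by
  classical
  intro v
  obtain ⟨a, b, p, hp, hall⟩ := hhypo v
  let f : G.induce {w : V | w ≠ v} →g G := (Embedding.induce {w : V | w ≠ v}).toHom
  have hf : Function.Injective f := Subtype.val_injective
  refine ⟨f a, f b, p.map f, ⟨hp.map hf, ?_⟩, ?_⟩
  · intro c d q hq
    by_contra hlt
    apply hnoham
    refine ⟨c, d, q, hq, ?_⟩
    have hcov : insert v (p.map f).support.toFinset = (Finset.univ : Finset V) := by
      ext w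
      simp only [Finset.mem_insert, List.mem_toFinset, Finset.mem_univ, iff_true]
      by_cases hw : w = v
      · exact Or.inl hw
      · right
        rw [Walk.support_map]
        exact List.mem_map.mpr ⟨⟨w, hw⟩, hall ⟨w, hw⟩, rfl⟩
    have h1 : Fintype.card V ≤ (p.map f).length + 2 := by
      rw [← Finset.card_univ, ← hcov]
      refine (Finset.card_insert_le _ _).trans ?_
      have := List.toFinset_card_le (p.map f).support
      rw [Walk.length_support] at this
      omega
    have h2 : q.support.toFinset.card = q.length + 1 := by
      rw [List.toFinset_card_of_nodup hq.support_nodup, Walk.length_support]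
    have h3 : q.support.toFinset = Finset.univ := by
      apply Finset.eq_univ_of_card
      have := Finset.card_le_univ q.support.toFinset
      omega
    intro w
    rw [← List.mem_toFinset, h3]
    exact Finset.mem_univ w
  · rw [Walk.support_map]
    intro h
    obtain ⟨x, _, hx⟩ := List.mem_map.mp h
    exact x.2 hx
end

section
/- For every finite tree (connected acyclic graph) T, there exists a vertex v of T such that every longest path in T contains v. -/
open SimpleGraph

theorem length_eq_dist_aux {V : Type} {T : SimpleGraph V}
    (hconn : T.Connected) (hacyc : T.IsAcyclic) {x y : V} (q : T.Walk x y) (hq : q.IsPath) :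
    q.length = T.dist x y := by
  obtain ⟨r, hr, hl⟩ := hconn.exists_path_of_dist x y
  have h := hacyc.path_unique ⟨q, hq⟩ ⟨r, hr⟩
  have h' : q = r := congrArg Subtype.val h
  rw [h', hl]

theorem dist_add_aux {V : Type} {T : SimpleGraph V}
    (hconn : T.Connected) (hacyc : T.IsAcyclic) {x y m : V} (q : T.Walk x y) (hq : q.IsPath)
    (hm : m ∈ q.support) : T.dist x m + T.dist m y = q.length := by
  obtain ⟨s, t, hs, ht, h⟩ := hq.mem_support_iff_exists_append.1 hm
  rw [h, Walk.length_append, length_eq_dist_aux hconn hacyc s hs,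
    length_eq_dist_aux hconn hacyc t ht]

theorem append_aux {V : Type} {T : SimpleGraph V}
    (hconn : T.Connected) (hacyc : T.IsAcyclic) {c m x : V} (s : T.Walk m x) (hs : s.IsPath)
    (hmin : ∀ z ∈ s.support, T.dist c m ≤ T.dist c z) :
    T.dist c x = T.dist c m + T.dist m x := by
  obtain ⟨r, hr, hl⟩ := hconn.exists_path_of_dist c m
  have hp : (r.append s).IsPath := by
    rw [Walk.isPath_def, Walk.support_append, List.nodup_append']
    have hn := hs.support_nodup
    refine ⟨hr.support_nodup, hn.tail, ?_⟩
    intro z hz hz'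
    have h1 := hmin z (List.mem_of_mem_tail hz')
    have h2 := dist_add_aux hconn hacyc r hr hz
    have h3 : T.dist z m = 0 := by omega
    rw [hconn.dist_eq_zero_iff] at h3
    subst h3
    rw [← Walk.cons_tail_support, List.nodup_cons] at hn
    exact hn.1 hz'
  rw [← length_eq_dist_aux hconn hacyc _ hp, Walk.length_append, hl,
    length_eq_dist_aux hconn hacyc s hs]

theorem proj_aux {V : Type} {T : SimpleGraph V}
    (hconn : T.Connected) (hacyc : T.IsAcyclic) {x y : V} (q : T.Walk x y) (hq : q.IsPath)
    (c : V) : ∃ m ∈ q.support, T.dist c x = T.dist c m + T.dist m x ∧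
      T.dist c y = T.dist c m + T.dist m y := by
  classical
  obtain ⟨m, hm, hmin⟩ := Finset.exists_min_image q.support.toFinset (fun z => T.dist c z)
    ⟨x, by simp⟩
  simp only [List.mem_toFinset] at hm hmin
  obtain ⟨s, t, hs, ht, h⟩ := hq.mem_support_iff_exists_append.1 hm
  refine ⟨m, hm, append_aux hconn hacyc s.reverse hs.reverse ?_,
    append_aux hconn hacyc t ht ?_⟩
  · intro z hz
    apply hmin
    rw [h, Walk.mem_support_append_iff]
    left; simpa using hz
  · intro z hz
    apply hmin
    rw [h, Walk.mem_support_append_iff]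
    exact Or.inr hz

/-- Every finite tree (connected acyclic graph) has a vertex contained in all of its
longest paths. -/
theorem gallai_tree {V : Type} [Fintype V] (T : SimpleGraph V)
    (hconn : T.Connected) (hacyc : T.IsAcyclic) :
    ∃ v : V, ∀ (a b : V) (p : T.Walk a b), IsLongestPath T p → v ∈ p.support := by
  by_cases hex : ∃ (a b : V) (p : T.Walk a b), IsLongestPath T p
  swap
  · obtain ⟨v⟩ := hconn.nonempty
    exact ⟨v, fun a b p hp => (hex ⟨a, b, p, hp⟩).elim⟩
  obtain ⟨a, b, p, hp, hmax⟩ := hex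
  have hD : ∀ x y, T.dist x y ≤ p.length := by
    intro x y
    obtain ⟨r, hr, hl⟩ := hconn.exists_path_of_dist x y
    exact hl ▸ hmax _ _ r hr
  have hecc : ∀ x, T.dist (p.getVert (p.length / 2)) x ≤ p.length - p.length / 2 := by
    intro x
    obtain ⟨m, hm, h1, h2⟩ := proj_aux hconn hacyc p hp x
    have h3 := dist_add_aux hconn hacyc p hp hm
    have h4 := hD x a
    have h5 := hD x b
    have h6 := hconn.dist_triangle (u := x) (v := m) (w := p.getVert (p.length / 2))
    have c1 := T.dist_comm (u := m) (v := a)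
    have c2 := T.dist_comm (u := x) (v := p.getVert (p.length / 2))
    have c3 := T.dist_comm (u := m) (v := p.getVert (p.length / 2))
    obtain ⟨s, t, hs, ht, h⟩ :=
      hp.mem_support_iff_exists_append.1 (p.getVert_mem_support (p.length / 2))
    have e1 := length_eq_dist_aux hconn hacyc _ (hp.take (p.length / 2))
    have e2 := length_eq_dist_aux hconn hacyc s hs
    have e3 : p.length = s.length + t.length := by
      rw [← Walk.length_append, ← h]
    rw [Walk.take_length] at e1
    have hm' : m ∈ s.support ∨ m ∈ t.support := by
      rw [← Walk.mem_support_append_iff, ← h]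
      exact hm
    rcases hm' with hm | hm
    · have := dist_add_aux hconn hacyc s hs hm
      omega
    · have := dist_add_aux hconn hacyc t ht hm
      omega
  refine ⟨p.getVert (p.length / 2), fun x y q hq => ?_⟩
  obtain ⟨m, hm, h1, h2⟩ := proj_aux hconn hacyc q hq.1 (p.getVert (p.length / 2))
  have h3 := dist_add_aux hconn hacyc q hq.1 hm
  have h4 := hecc x
  have h5 := hecc y
  have h6 := hq.2 _ _ p hp
  have c1 := T.dist_comm (u := m) (v := x)
  have h0 : T.dist (p.getVert (p.length / 2)) m = 0 := by omega
  rw [hconn.dist_eq_zero_iff] at h0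
  rwa [h0]
end

section
/- There exists a finite connected graph G and a 3-tree T on the same vertex set such that G is a spanning subgraph of T and no vertex of G lies on all longest paths of G; in particular, Gallai's question has a negative answer for connected partial 3-trees. -/
open SimpleGraph

/-- The graph obtained from `G` by adding one new vertex adjacent exactly to `x`, `y`
and `z`. -/
def SimpleGraph.addLink3 {V : Type u} (G : SimpleGraph V) (x y z : V) :
    SimpleGraph (Option V) :=
  SimpleGraph.fromRel (fun a b =>
    (∃ u w : V, a = some u ∧ b = some w ∧ G.Adj u w) ∨
    (a = none ∧ (b = some x ∨ b = some y ∨ b = some z)))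

/-- Skeletons of 3-trees: `K₃` is a 3-tree, and adding a new vertex adjacent exactly to
the three vertices of a triangle of a 3-tree yields a 3-tree. -/
inductive IsThreeTreeSkel : (W : Type u) → SimpleGraph W → Prop
  | base : IsThreeTreeSkel (ULift (Fin 3)) ⊤
  | extend {W : Type u} {G : SimpleGraph W} {x y z : W} :
      IsThreeTreeSkel W G → G.Adj x y → G.Adj x z → G.Adj y z →
      IsThreeTreeSkel (Option W) (G.addLink3 x y z)

/-- A graph is a 3-tree if it is isomorphic to a 3-tree skeleton. -/
def IsThreeTree {V : Type u} (G : SimpleGraph V) : Prop :=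
  ∃ (W : Type u) (H : SimpleGraph W), IsThreeTreeSkel W H ∧ Nonempty (G ≃g H)

namespace Gal

/-- Neighbour lists of the 12-vertex Walther-Zamfirescu graph. -/
def nb (v : Fin 12) : List (Fin 12) :=
  match v with
  | 0 => [3]
  | 1 => [4]
  | 2 => [5]
  | 3 => [0, 7, 11]
  | 4 => [1, 6, 9]
  | 5 => [2, 8, 10]
  | 6 => [4, 10, 11]
  | 7 => [3, 9, 10]
  | 8 => [5, 9, 11]
  | 9 => [4, 7, 8]
  | 10 => [5, 6, 7]
  | 11 => [3, 6, 8]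

def G : SimpleGraph (Fin 12) where
  Adj a b := b ∈ nb a
  symm := ⟨by decide +kernel⟩
  loopless := ⟨by decide +kernel⟩

instance : DecidableRel G.Adj := fun a b => inferInstanceAs (Decidable (b ∈ nb a))

/-- Is there a path with `n` edges from `v` whose later vertices avoid `vis`? -/
def search : ℕ → List (Fin 12) → Fin 12 → Bool
  | 0, _, _ => true
  | n + 1, vis, v => (nb v).any fun w => !(vis.contains w) && search n (w :: vis) w

theorem search_of_path {a b : Fin 12} (q : G.Walk a b) :
    ∀ (n : ℕ) (vis : List (Fin 12)), q.IsPath → n ≤ q.length →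
      (∀ x ∈ q.support.tail, x ∉ vis) → search n vis a = true := by
  induction q with
  | nil =>
    intro n vis _ hn _
    simp only [SimpleGraph.Walk.length_nil, Nat.le_zero] at hn
    subst hn
    rfl
  | @cons u v w h q ih =>
    intro n vis hp hn hv
    cases n with
    | zero => rfl
    | succ n =>
      rw [SimpleGraph.Walk.cons_isPath_iff] at hp
      simp only [SimpleGraph.Walk.length_cons, Nat.add_le_add_iff_right] at hn
      simp only [SimpleGraph.Walk.support_cons, List.tail_cons] at hv
      simp only [search, List.any_eq_true]
      refine ⟨v, h, ?_⟩
      have h1 : v ∉ vis := hv v q.start_mem_support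
      have h2 : search n (v :: vis) v = true := by
        refine ih n (v :: vis) hp.1 hn ?_
        intro x hx hmem
        rcases List.mem_cons.1 hmem with rfl | hm
        · have hnd := hp.1.support_nodup
          rw [← SimpleGraph.Walk.cons_tail_support] at hnd
          exact (List.nodup_cons.1 hnd).1 hx
        · exact hv x (List.mem_of_mem_tail hx) hm
      simp [h1, h2]

theorem no_long : ∀ v : Fin 12, search 10 [v] v = false := by decide +kernel

theorem length_le {a b : Fin 12} (q : G.Walk a b) (hq : q.IsPath) : q.length ≤ 9 := by
  by_contra hlt
  have h := search_of_path q 10 [a] hq (by omega) (by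
    intro x hx hm
    have hnd := hq.support_nodup
    rw [← SimpleGraph.Walk.cons_tail_support] at hnd
    rw [List.mem_singleton.1 hm] at hx
    exact (List.nodup_cons.1 hnd).1 hx)
  rw [no_long a] at h
  exact absurd h (by decide)

theorem exists_walk (l : List (Fin 12)) : ∀ a : Fin 12, List.IsChain G.Adj (a :: l) →
    ∃ (b : Fin 12) (p : G.Walk a b), p.support = a :: l := by
  induction l with
  | nil => exact fun a _ => ⟨a, .nil, rfl⟩
  | cons c l ih =>
    intro a h
    rw [List.isChain_cons_cons] at h
    obtain ⟨b, p, hp⟩ := ih c h.2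
    exact ⟨b, .cons h.1 p, by simp [hp]⟩

/-- A longest path (start vertex, rest) avoiding the given vertex. -/
def avoid (v : Fin 12) : Fin 12 × List (Fin 12) :=
  match v with
  | 0 => (1, [4, 6, 10, 5, 8, 9, 7, 3, 11])
  | 1 => (0, [3, 7, 9, 4, 6, 10, 5, 8, 11])
  | 2 => (0, [3, 7, 9, 4, 6, 10, 5, 8, 11])
  | 3 => (1, [4, 6, 11, 8, 9, 7, 10, 5, 2])
  | 4 => (0, [3, 7, 9, 8, 11, 6, 10, 5, 2])
  | 5 => (0, [3, 7, 10, 6, 11, 8, 9, 4, 1])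
  | 6 => (0, [3, 11, 8, 5, 10, 7, 9, 4, 1])
  | 7 => (0, [3, 11, 6, 10, 5, 8, 9, 4, 1])
  | 8 => (0, [3, 11, 6, 4, 9, 7, 10, 5, 2])
  | 9 => (0, [3, 7, 10, 5, 8, 11, 6, 4, 1])
  | 10 => (0, [3, 7, 9, 4, 6, 11, 8, 5, 2])
  | 11 => (0, [3, 7, 9, 8, 5, 10, 6, 4, 1])

theorem avoid_spec : ∀ v : Fin 12, List.IsChain G.Adj ((avoid v).1 :: (avoid v).2) ∧
    ((avoid v).1 :: (avoid v).2).Nodup ∧ (avoid v).2.length = 9 ∧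
    v ∉ ((avoid v).1 :: (avoid v).2) := by decide +kernel

theorem exists_avoiding (v : Fin 12) :
    ∃ (a b : Fin 12) (p : G.Walk a b), IsLongestPath G p ∧ v ∉ p.support := by
  obtain ⟨h1, h2, h3, h4⟩ := avoid_spec v
  obtain ⟨b, p, hp⟩ := exists_walk _ _ h1
  have hlen : p.length = 9 := by
    have := p.length_support
    rw [hp, List.length_cons, h3] at this
    omega
  refine ⟨_, b, p, ⟨?_, ?_⟩, by rw [hp]; exact h4⟩
  · rw [SimpleGraph.Walk.isPath_def, hp]
    exact h2
  · intro c d q hq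
    rw [hlen]
    exact length_le q hq

theorem connected : G.Connected := by
  have key : ∀ v : Fin 12, G.Reachable 0 v := by
    intro v
    have e : ∀ a b : Fin 12, b ∈ nb a → G.Reachable a b :=
      fun a b h => SimpleGraph.Adj.reachable (G := G) h
    have r3 := e 0 3 (by decide)
    have r7 := r3.trans (e 3 7 (by decide))
    have r11 := r3.trans (e 3 11 (by decide))
    have r9 := r7.trans (e 7 9 (by decide))
    have r10 := r7.trans (e 7 10 (by decide))
    have r8 := r11.trans (e 11 8 (by decide))
    have r6 := r11.trans (e 11 6 (by decide))
    have r5 := r8.trans (e 8 5 (by decide))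
    have r4 := r6.trans (e 6 4 (by decide))
    have r2 := r5.trans (e 5 2 (by decide))
    have r1 := r4.trans (e 4 1 (by decide))
    have r0 : G.Reachable 0 0 := SimpleGraph.Reachable.refl _
    fin_cases v <;> assumption
  exact { preconnected := fun a b => (key a).symm.trans (key b), nonempty := ⟨0⟩ }

/-- Boolean-friendly description of adjacency in `addLink3`. -/
instance decLink {V : Type u} [DecidableEq V] (H : SimpleGraph V) [DecidableRel H.Adj]
    (x y z : V) : DecidableRel (H.addLink3 x y z).Adj := fun a b =>
  match a, b with
  | none, none => isFalse (by simp)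
  | none, some b => decidable_of_iff (b = x ∨ b = y ∨ b = z)
      (by simp [SimpleGraph.addLink3])
  | some a, none => decidable_of_iff (a = x ∨ a = y ∨ a = z)
      (by simp [SimpleGraph.addLink3])
  | some a, some b => decidable_of_iff (H.Adj a b) (by
      simp only [SimpleGraph.addLink3, SimpleGraph.fromRel_adj]
      constructor
      · intro h
        exact ⟨by simpa using h.ne, Or.inl (Or.inl ⟨a, b, rfl, rfl, h⟩)⟩
      · rintro ⟨_, (⟨u, w, hu, hw, h⟩ | ⟨h, _⟩) | (⟨u, w, hu, hw, h⟩ | ⟨h, _⟩)⟩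
        · cases hu; cases hw; exact h
        · cases h
        · cases hu; cases hw; exact h.symm
        · cases h)

abbrev W0 := ULift.{0} (Fin 3)
abbrev W1 := Option W0
abbrev W2 := Option W1
abbrev W3 := Option W2
abbrev W4 := Option W3
abbrev W5 := Option W4
abbrev W6 := Option W5
abbrev W7 := Option W6
abbrev W8 := Option W7
abbrev W9 := Option W8

def e0 : Fin 3 ≃ W0 := Equiv.ulift.symm
def e1 : Fin 4 ≃ W1 := (finSuccEquiv 3).trans e0.optionCongr
def e2 : Fin 5 ≃ W2 := (finSuccEquiv 4).trans e1.optionCongr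
def e3 : Fin 6 ≃ W3 := (finSuccEquiv 5).trans e2.optionCongr
def e4 : Fin 7 ≃ W4 := (finSuccEquiv 6).trans e3.optionCongr
def e5 : Fin 8 ≃ W5 := (finSuccEquiv 7).trans e4.optionCongr
def e6 : Fin 9 ≃ W6 := (finSuccEquiv 8).trans e5.optionCongr
def e7 : Fin 10 ≃ W7 := (finSuccEquiv 9).trans e6.optionCongr
def e8 : Fin 11 ≃ W8 := (finSuccEquiv 10).trans e7.optionCongr
def e9 : Fin 12 ≃ W9 := (finSuccEquiv 11).trans e8.optionCongr

/-! The new vertex of `Hk` is the vertex `9 - k` of the final graph; at that moment the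
final vertex `j` has index `j - (10 - k)`. -/
def H0 : SimpleGraph W0 := ⊤
def H1 : SimpleGraph W1 := H0.addLink3 (e0 0) (e0 1) (e0 2)
def H2 : SimpleGraph W2 := H1.addLink3 (e1 1) (e1 2) (e1 3)
def H3 : SimpleGraph W3 := H2.addLink3 (e2 2) (e2 3) (e2 4)
def H4 : SimpleGraph W4 := H3.addLink3 (e3 2) (e3 4) (e3 5)
def H5 : SimpleGraph W5 := H4.addLink3 (e4 1) (e4 4) (e4 5)
def H6 : SimpleGraph W6 := H5.addLink3 (e5 3) (e5 5) (e5 7)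
def H7 : SimpleGraph W7 := H6.addLink3 (e6 2) (e6 5) (e6 7)
def H8 : SimpleGraph W8 := H7.addLink3 (e7 2) (e7 4) (e7 7)
def H9 : SimpleGraph W9 := H8.addLink3 (e8 2) (e8 6) (e8 10)

instance d0 : DecidableRel H0.Adj := inferInstanceAs (DecidableRel (⊤ : SimpleGraph W0).Adj)
instance d1 : DecidableRel H1.Adj := decLink H0 _ _ _
instance d2 : DecidableRel H2.Adj := decLink H1 _ _ _
instance d3 : DecidableRel H3.Adj := decLink H2 _ _ _
instance d4 : DecidableRel H4.Adj := decLink H3 _ _ _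
instance d5 : DecidableRel H5.Adj := decLink H4 _ _ _
instance d6 : DecidableRel H6.Adj := decLink H5 _ _ _
instance d7 : DecidableRel H7.Adj := decLink H6 _ _ _
instance d8 : DecidableRel H8.Adj := decLink H7 _ _ _
instance d9 : DecidableRel H9.Adj := decLink H8 _ _ _

theorem skel : IsThreeTreeSkel W9 H9 := by
  have s0 : IsThreeTreeSkel W0 H0 := .base
  have s1 : IsThreeTreeSkel W1 H1 :=
    .extend s0 (by decide +kernel) (by decide +kernel) (by decide +kernel)
  have s2 : IsThreeTreeSkel W2 H2 :=
    .extend s1 (by decide +kernel) (by decide +kernel) (by decide +kernel)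
  have s3 : IsThreeTreeSkel W3 H3 :=
    .extend s2 (by decide +kernel) (by decide +kernel) (by decide +kernel)
  have s4 : IsThreeTreeSkel W4 H4 :=
    .extend s3 (by decide +kernel) (by decide +kernel) (by decide +kernel)
  have s5 : IsThreeTreeSkel W5 H5 :=
    .extend s4 (by decide +kernel) (by decide +kernel) (by decide +kernel)
  have s6 : IsThreeTreeSkel W6 H6 :=
    .extend s5 (by decide +kernel) (by decide +kernel) (by decide +kernel)
  have s7 : IsThreeTreeSkel W7 H7 :=
    .extend s6 (by decide +kernel) (by decide +kernel) (by decide +kernel)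
  have s8 : IsThreeTreeSkel W8 H8 :=
    .extend s7 (by decide +kernel) (by decide +kernel) (by decide +kernel)
  exact .extend s8 (by decide +kernel) (by decide +kernel) (by decide +kernel)

theorem sub : ∀ a b : Fin 12, b ∈ nb a → H9.Adj (e9 a) (e9 b) := by decide +kernel

end Gal

/-- There is a finite connected spanning subgraph `G` of a 3-tree `T` (a connected partial
3-tree) in which no vertex lies on all longest paths: Gallai's question has a negative
answer for connected partial 3-trees. -/
theorem gallai_fails_for_partial_three_trees :
    ∃ (V : Type) (_ : Fintype V) (G T : SimpleGraph V),
      G ≤ T ∧ IsThreeTree T ∧ G.Connected ∧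
      ∀ v : V, ∃ (a b : V) (p : G.Walk a b), IsLongestPath G p ∧ v ∉ p.support := by
  refine ⟨Fin 12, inferInstance, Gal.G, Gal.H9.comap Gal.e9, ?_, ?_, Gal.connected,
    Gal.exists_avoiding⟩
  · intro a b h
    exact Gal.sub a b h
  · exact ⟨Gal.W9, Gal.H9, Gal.skel, ⟨SimpleGraph.Iso.comap Gal.e9 Gal.H9⟩⟩
end
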